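/- Let 𝓜 be the improvement MDP of an MDP M and a preference model ⟨𝔽, ⊵⟩, with level sets W_i and R_i as computed by the level-set algorithm. For every k ≥ 1, every s ∈ S, and every m ∈ {0,1}: if there exists a strategy π in 𝓜 such that every play v₀v₁… of 𝓜 consistent with π from v₀ = (s,m) visits 𝓕 at least k times at positive indices (there exist 1 ≤ i₁ < … < i_k with v_{i_j} ∈ 𝓕), then (s,0) ∈ W_k. In other words, at most rank((s,m))-many visits to 𝓕 are almost-surely guaranteed from (s,m), where rank((s,0)) = rank((s,1)) is the largest k with (s,0) ∈ W_k. -/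

import Mathlib

/-!
Framework for MDPs with preference models over reachability objectives,
following "Opportunistic Qualitative Planning in Stochastic Systems with
Incomplete Preferences over Reachability Objectives".
-/

/-- The infinite sequence `ν ρ`: the finite prefix `ν` followed by the suffix `ρ`. -/
def appendSeq {V : Type} (ν : List V) (ρ : ℕ → V) : ℕ → V :=
  fun i => if h : i < ν.length then ν.get ⟨i, h⟩ else ρ (i - ν.length)

/-- The history `s₀ … s_{k+i}`: the prefix `ν = s₀ … s_k` followed by the
first `i` states of the suffix `ρ`. -/
def histSeq {V : Type} (ν : List V) (ρ : ℕ → V) (i : ℕ) : List V :=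
  ν ++ (List.range i).map ρ

/-- The state from which the `i`-th action along the suffix is taken:
the last state of `ν` if `i = 0` (the default is irrelevant for nonempty `ν`),
and `ρ (i-1)` otherwise. -/
def curState {V : Type} (ν : List V) (ρ : ℕ → V) : ℕ → V
  | 0 => ν.getLastD (ρ 0)
  | j + 1 => ρ j

/-- Consistency of an infinite suffix `ρ` with a strategy `π` after the prefix `ν`,
relative to an enabledness relation `Δ`: for every `i ≥ 0` there is an action
`a ∈ π(s₀ … s_{k+i})` with the transition to the next state enabled. -/
def ConsistentRel {V A : Type} (Δ : V → A → V → Prop) (π : List V → Set A)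
    (ν : List V) (ρ : ℕ → V) : Prop :=
  ∀ i : ℕ, ∃ a ∈ π (histSeq ν ρ i), Δ (curState ν ρ i) a (ρ i)

/-- The cone: the set of infinite suffixes of `ν` consistent with `π`. -/
def ConeRel {V A : Type} (Δ : V → A → V → Prop) (ν : List V) (π : List V → Set A) :
    Set (ℕ → V) :=
  { ρ | ConsistentRel Δ π ν ρ }

/-- A Markov decision process with states `S`, actions `A`, transition
probability function `T` and initial state `init`. -/
structure MDP (S A : Type) where
  T : S → A → PMF S
  init : S

namespace MDP

variable {S A : Type}

/-- `T(s,a,s') > 0`. -/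
def Enabled (M : MDP S A) (s : S) (a : A) (s' : S) : Prop := M.T s a s' ≠ 0

/-- A play: an infinite state sequence each of whose steps is enabled by some action. -/
def IsPlay (M : MDP S A) (ρ : ℕ → S) : Prop :=
  ∀ i : ℕ, ∃ a : A, M.Enabled (ρ i) a (ρ (i + 1))

/-- A prefix: a finite nonempty initial segment of a play of `M`. -/
def IsPrefix (M : MDP S A) (ν : List S) : Prop :=
  ν ≠ [] ∧ ∃ ρ : ℕ → S, M.IsPlay ρ ∧ ν = (List.range ν.length).map ρ

/-- `Cone(M, ν, π)`: the suffixes of `ν` consistent with `π` in `M`. -/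
def Cone (M : MDP S A) (ν : List S) (π : List S → Set A) : Set (ℕ → S) :=
  ConeRel M.Enabled ν π

end MDP

/-- `Reach(F)`: the set of infinite sequences visiting a state of `F`. -/
def ReachSet {S : Type} (F : Set S) : Set (ℕ → S) := { ρ | ∃ i : ℕ, ρ i ∈ F }

/-- A preference model `⟨𝔽, ⊵⟩` over reachability objectives: a finite set `objs`
of reachability objectives together with a reflexive and transitive relation
`pref` (`⊵`) on it. -/
structure PrefModel (S : Type) where
  objs : Set (Set (ℕ → S))
  finite : objs.Finite
  isReach : ∀ R ∈ objs, ∃ F : Set S, R = ReachSet F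
  pref : Set (ℕ → S) → Set (ℕ → S) → Prop
  refl : ∀ R ∈ objs, pref R R
  trans : ∀ R ∈ objs, ∀ R' ∈ objs, ∀ R'' ∈ objs,
    pref R R' → pref R' R'' → pref R R''

namespace PrefModel

variable {S A : Type}

/-- Strict preference `R' ▷ R`: `R' ⊵ R` and not `R ⊵ R'`. -/
def SPref (P : PrefModel S) (R' R : Set (ℕ → S)) : Prop :=
  P.pref R' R ∧ ¬ P.pref R R'

/-- `MP(𝕏)`: the most-preferred outcomes in `𝕏`. -/
def MPset (P : PrefModel S) (X : Set (Set (ℕ → S))) : Set (Set (ℕ → S)) :=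
  { R | R ∈ X ∧ ¬ ∃ R' ∈ X, P.SPref R' R }

/-- `Outcomes(ν)`: the objectives in `𝔽` for which some strategy forces every
consistent play `νρ` to satisfy the objective. -/
def Outcomes (M : MDP S A) (P : PrefModel S) (ν : List S) : Set (Set (ℕ → S)) :=
  { R | R ∈ P.objs ∧ ∃ π : List S → Set A,
      (∀ w : List S, (π w).Nonempty) ∧ ∀ ρ ∈ M.Cone ν π, appendSeq ν ρ ∈ R }

/-- `MP(s) = MP(Outcomes(s))` for a state `s`. -/
def MPst (P : PrefModel S) (M : MDP S A) (s : S) : Set (Set (ℕ → S)) :=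
  P.MPset (P.Outcomes M [s])

end PrefModel

/-- `Δ(v,a,v') > 0`: the enabled transitions of the improvement MDP of `M` and `P`.
States are pairs `(s, m)` with `m : Bool` (`true` = memory bit 1). -/
def ImpEnabled {S A : Type} (M : MDP S A) (P : PrefModel S) :
    S × Bool → A → S × Bool → Prop :=
  fun v a v' =>
    M.Enabled v.1 a v'.1 ∧
    (¬ ∃ R ∈ P.MPst M v.1, ∃ R' ∈ P.MPst M v'.1, P.SPref R R') ∧
    (v'.2 = true ↔ ∃ R ∈ P.MPst M v.1, ∃ R' ∈ P.MPst M v'.1, P.SPref R' R)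

/-- The final states `𝓕 = S × {1}` of the improvement MDP. -/
def ImpFinal {S : Type} : Set (S × Bool) := { v | v.2 = true }

/-- Plays of the improvement MDP. -/
def IsImpPlay {S A : Type} (M : MDP S A) (P : PrefModel S) (ϱ : ℕ → S × Bool) : Prop :=
  ∀ i : ℕ, ∃ a : A, ImpEnabled M P (ϱ i) a (ϱ (i + 1))

/-- The almost-sure winning region for visiting `Target`, w.r.t. the enabledness
relation `Δ`: states `v` from which some strategy forces every consistent play
(from the one-state prefix `⟨v⟩`) to visit `Target`. -/
def ASWinSet {V A : Type} (Δ : V → A → V → Prop) (Target : Set V) : Set V :=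
  { v | ∃ π : List V → Set A, (∀ w : List V, (π w).Nonempty) ∧
      ∀ ρ ∈ ConeRel Δ [v] π, ∃ k : ℕ, appendSeq [v] ρ k ∈ Target }

/-- The sets `R_i` of the level-set algorithm: `R₀ = 𝓕`,
`R_{i+1} = {(s,1) ∈ 𝓕 ∣ (s,0) ∈ W_{i+1} = ASWin(R_i)}`. -/
def Rlev {S A : Type} (M : MDP S A) (P : PrefModel S) : ℕ → Set (S × Bool)
  | 0 => ImpFinal
  | i + 1 => { v | v ∈ (ImpFinal : Set (S × Bool)) ∧
      (v.1, false) ∈ ASWinSet (ImpEnabled M P) (Rlev M P i) }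

/-- The level sets `W_i = ASWin(R_{i-1})` (meaningful for `i ≥ 1`). -/
def Wlev {S A : Type} (M : MDP S A) (P : PrefModel S) (i : ℕ) : Set (S × Bool) :=
  ASWinSet (ImpEnabled M P) (Rlev M P (i - 1))

theorem appendSeq_singleton_zero {V : Type} (v : V) (ρ : ℕ → V) :
    appendSeq [v] ρ 0 = v := rfl

theorem appendSeq_singleton_succ {V : Type} (v : V) (ρ : ℕ → V) (n : ℕ) :
    appendSeq [v] ρ (n + 1) = ρ n := by
  simp [appendSeq]

/-- Consistency from a one-state prefix, with the current state read off the play. -/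
theorem mem_coneRel_singleton {V A : Type} {Δ : V → A → V → Prop} {π : List V → Set A}
    {v : V} {ρ : ℕ → V} :
    ρ ∈ ConeRel Δ [v] π ↔
      ∀ i, ∃ a ∈ π (v :: (List.range i).map ρ), Δ (appendSeq [v] ρ i) a (ρ i) := by
  refine forall_congr' fun i => ?_
  cases i with
  | zero => rfl
  | succ n => rw [appendSeq_singleton_succ]; rfl

/-- If `v` and `v'` have the same enabled transitions, a strategy can be transferred
from `v` to `v'` without changing the consistent suffixes. -/
theorem coneRel_singleton_transfer {V A : Type} {Δ : V → A → V → Prop} {π : List V → Set A}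
    {v v' : V} (hΔ : ∀ a u, Δ v a u ↔ Δ v' a u) :
    ConeRel Δ [v'] (fun w => π (v :: w.tail)) = ConeRel Δ [v] π := by
  ext ρ
  simp only [mem_coneRel_singleton]
  refine forall_congr' fun i => ?_
  cases i with
  | zero => simp [appendSeq_singleton_zero, hΔ]
  | succ n => simp [appendSeq_singleton_succ]

/-- The suffix that follows `ρ` before index `i`, then visits `ρ i` and continues with `ρ'`. -/
def spliceSeq {V : Type} (ρ : ℕ → V) (i : ℕ) (ρ' : ℕ → V) (n : ℕ) : V :=
  if n < i then ρ n else appendSeq [ρ i] ρ' (n - i)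

theorem spliceSeq_of_le {V : Type} {ρ : ℕ → V} {i : ℕ} {ρ' : ℕ → V} {n : ℕ} (hn : n ≤ i) :
    spliceSeq ρ i ρ' n = ρ n := by
  rcases hn.lt_or_eq with h | rfl
  · simp [spliceSeq, h]
  · simp [spliceSeq, appendSeq_singleton_zero]

theorem spliceSeq_add {V : Type} (ρ : ℕ → V) (i : ℕ) (ρ' : ℕ → V) (j : ℕ) :
    spliceSeq ρ i ρ' (i + j) = appendSeq [ρ i] ρ' j := by
  simp [spliceSeq]

theorem map_spliceSeq_range {V : Type} (ρ : ℕ → V) (i : ℕ) (ρ' : ℕ → V) {n : ℕ}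
    (hn : n ≤ i + 1) : (List.range n).map (spliceSeq ρ i ρ') = (List.range n).map ρ := by
  refine List.map_congr_left fun x hx => spliceSeq_of_le ?_
  have := List.mem_range.1 hx
  omega

theorem map_spliceSeq_range_add {V : Type} (ρ : ℕ → V) (i : ℕ) (ρ' : ℕ → V) (j : ℕ) :
    (List.range (i + 1 + j)).map (spliceSeq ρ i ρ') =
      (List.range i).map ρ ++ ρ i :: (List.range j).map ρ' := by
  rw [List.range_add, List.map_append, map_spliceSeq_range ρ i ρ' le_rfl, List.range_succ]
  simp only [List.map_append, List.map_map, List.map_cons, List.map_nil, List.append_assoc,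
    List.singleton_append]
  congr 2
  refine List.map_congr_left fun x _ => ?_
  rw [Function.comp_apply, add_assoc, add_comm 1 x, spliceSeq_add, appendSeq_singleton_succ]

/-- A suffix consistent with the residual strategy after a consistent history
extends that history to a consistent suffix. -/
theorem spliceSeq_mem_coneRel {V A : Type} {Δ : V → A → V → Prop} {π : List V → Set A}
    {v : V} {ρ ρ' : ℕ → V} {i : ℕ} (hρ : ρ ∈ ConeRel Δ [v] π)
    (hρ' : ρ' ∈ ConeRel Δ [ρ i] (fun w => π (v :: (List.range i).map ρ ++ w))) :
    spliceSeq ρ i ρ' ∈ ConeRel Δ [v] π := by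
  rw [mem_coneRel_singleton] at *
  intro n
  rcases le_or_gt n i with hn | hn
  · obtain ⟨a, ha, hΔ⟩ := hρ n
    rw [map_spliceSeq_range ρ i ρ' (by omega), spliceSeq_of_le hn]
    refine ⟨a, ha, ?_⟩
    cases n with
    | zero => exact hΔ
    | succ m =>
      rw [appendSeq_singleton_succ] at hΔ ⊢
      rwa [spliceSeq_of_le (by omega)]
  · obtain ⟨j, rfl⟩ := Nat.exists_eq_add_of_le (Nat.succ_le_of_lt hn)
    obtain ⟨a, ha, hΔ⟩ := hρ' j
    rw [Nat.succ_eq_add_one, map_spliceSeq_range_add]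
    refine ⟨a, ha, ?_⟩
    have hcur : appendSeq [v] (spliceSeq ρ i ρ') (i + 1 + j) = appendSeq [ρ i] ρ' j := by
      rw [show i + 1 + j = i + j + 1 by omega, appendSeq_singleton_succ, spliceSeq_add]
    rwa [hcur, show i + 1 + j = i + (j + 1) by omega, spliceSeq_add, appendSeq_singleton_succ]

/-- After the first visit to `F`, the residual strategy guarantees all visits but one. -/
theorem residual_visits {V A : Type} {Δ : V → A → V → Prop} {π : List V → Set A} {F : Set V}
    {k : ℕ} {v : V} {ρ : ℕ → V} {i : ℕ}
    (hπ : ∀ ρ ∈ ConeRel Δ [v] π, ∃ f : Fin (k + 1) → ℕ, StrictMono f ∧ (∀ j, 1 ≤ f j) ∧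
      ∀ j, appendSeq [v] ρ (f j) ∈ F)
    (hρ : ρ ∈ ConeRel Δ [v] π) (hfirst : ∀ n < i, ρ n ∉ F) :
    ∀ ρ' ∈ ConeRel Δ [ρ i] (fun w => π (v :: (List.range i).map ρ ++ w)),
      ∃ f : Fin k → ℕ, StrictMono f ∧ (∀ j, 1 ≤ f j) ∧
        ∀ j, appendSeq [ρ i] ρ' (f j) ∈ F := by
  intro ρ' hρ'
  obtain ⟨f, hmono, hpos, hF⟩ := hπ _ (spliceSeq_mem_coneRel hρ hρ')
  have hvisit : ∀ j, spliceSeq ρ i ρ' (f j - 1) ∈ F := fun j => by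
    have := hF j
    rwa [← Nat.sub_add_cancel (hpos j), appendSeq_singleton_succ] at this
  have hzero : i + 1 ≤ f 0 := by
    by_contra! hlt
    have hlt' : f 0 - 1 < i := by have := hpos 0; omega
    have := hvisit 0
    rw [spliceSeq_of_le hlt'.le] at this
    exact hfirst _ hlt' this
  have hlater : ∀ j : Fin k, i + 1 < f j.succ := fun j =>
    hzero.trans_lt (hmono (Fin.succ_pos j))
  refine ⟨fun j => f j.succ - (i + 1), fun j l hjl => ?_, fun j => ?_, fun j => ?_⟩
  · have := hmono (Fin.succ_lt_succ_iff.2 hjl)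
    have := hlater j
    dsimp only
    omega
  · have := hlater j
    dsimp only
    omega
  · have := hlater j
    rw [← spliceSeq_add, show i + (f j.succ - (i + 1)) = f j.succ - 1 by omega]
    exact hvisit j.succ

/-- if some strategy in the improvement MDP forces every consistent
play from `(s,m)` to visit `𝓕` at least `k` times at positive indices, then
`(s,0) ∈ W_k`; i.e., at most `rank((s,m))`-many visits to `𝓕` are almost-surely
guaranteed. -/
theorem at_most_rank_many_visits {S A : Type} [Fintype S] [Fintype A]
    (M : MDP S A) (P : PrefModel S) (k : ℕ) (hk : 1 ≤ k) (s : S) (m : Bool)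
    (h : ∃ π : List (S × Bool) → Set A, (∀ w, (π w).Nonempty) ∧
      ∀ ρ ∈ ConeRel (ImpEnabled M P) [(s, m)] π,
        ∃ f : Fin k → ℕ, StrictMono f ∧ (∀ j : Fin k, 1 ≤ f j) ∧
          ∀ j : Fin k, appendSeq [(s, m)] ρ (f j) ∈ ImpFinal) :
    (s, false) ∈ Wlev M P k := by
  induction k, hk using Nat.le_induction generalizing s m with
  | base =>
    obtain ⟨π, hne, hπ⟩ := h
    refine ⟨fun w => π ((s, m) :: w.tail), fun w => hne _, fun ρ hρ => ?_⟩
    rw [coneRel_singleton_transfer (π := π) (v := (s, m)) (v' := (s, false)) fun _ _ => Iff.rfl] at hρ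
    obtain ⟨f, -, hpos, hF⟩ := hπ ρ hρ
    refine ⟨f 0, ?_⟩
    have := hF 0
    rw [← Nat.sub_add_cancel (hpos 0), appendSeq_singleton_succ] at this ⊢
    exact this
  | succ k hk ih =>
    classical
    obtain ⟨π, hne, hπ⟩ := h
    refine ⟨fun w => π ((s, m) :: w.tail), fun w => hne _, fun ρ hρ => ?_⟩
    rw [coneRel_singleton_transfer (π := π) (v := (s, m)) (v' := (s, false)) fun _ _ => Iff.rfl] at hρ
    have hex : ∃ n, ρ n ∈ (ImpFinal : Set (S × Bool)) := by
      obtain ⟨f, -, hpos, hF⟩ := hπ ρ hρ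
      have := hF 0
      rw [← Nat.sub_add_cancel (hpos 0), appendSeq_singleton_succ] at this
      exact ⟨_, this⟩
    refine ⟨Nat.find hex + 1, ?_⟩
    rw [appendSeq_singleton_succ]
    have hW : ((ρ (Nat.find hex)).1, false) ∈ Wlev M P k :=
      ih _ (ρ (Nat.find hex)).2
        ⟨_, fun w => hne _, residual_visits hπ hρ fun n hn => Nat.find_min hex hn⟩
    obtain ⟨l, rfl⟩ := Nat.exists_eq_add_of_le' hk
    exact ⟨Nat.find_spec hex, hW⟩
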